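/- (Weighted Sobolev Theorem, main analytic result.) Let $d \ge 2$ and let $V : I_0 \to \mathbb{R}$ be measurable on the unit torus with $e^V + e^{-V} \in L^1(I_0)$. Then there exist a positive bounded measurable function $w$ on $I_0$, an exponent $r^* > 2$, and a constant $c > 0$ such that for every $C^1$ function $f$ on $I_0$ with $\int_{I_0} f\,dx = 0$: $\Big(\int_{I_0} |f(x)|^{r^*} w(x)\,dx\Big)^{2/r^*} \le c \int_{I_0} |\nabla f(x)|^2 e^{-V(x)}\,dx$. -/

import Mathlib

open MeasureTheory
open scoped ENNReal

theorem rpow_lintegral_mul_le {α : Type*} [MeasurableSpace α] (μ : Measure α) {p : ℝ}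
    (hp : 1 < p) {g k : α → ℝ≥0∞} (hg : AEMeasurable g μ) (hk : AEMeasurable k μ) :
    (∫⁻ a, g a * k a ∂μ) ^ p ≤ (∫⁻ a, g a ∂μ) ^ (p - 1) * ∫⁻ a, g a * k a ^ p ∂μ := by
  have hp0 : 0 < p := zero_lt_one.trans hp
  have hpq := (Real.HolderConjugate.conjExponent hp).symm
  set q := p.conjExponent with hq
  have hq0 : 0 < q := hpq.pos
  have hsum : 1 / q + 1 / p = 1 := by simpa using hpq.inv_add_inv_eq_one
  have h := ENNReal.lintegral_mul_le_Lp_mul_Lq μ hpq (f := fun a => g a ^ (1 / q))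
    (g := fun a => g a ^ (1 / p) * k a) (hg.pow_const _) ((hg.pow_const _).mul hk)
  have e1 : ∀ a, ((fun a => g a ^ (1 / q)) * fun a => g a ^ (1 / p) * k a) a = g a * k a := by
    intro a
    simp only [Pi.mul_apply]
    rw [← mul_assoc, ← ENNReal.rpow_add_of_nonneg _ _ (by positivity) (by positivity), hsum,
      ENNReal.rpow_one]
  have e2 : ∀ a, (g a ^ (1 / q)) ^ q = g a := fun a => by
    rw [← ENNReal.rpow_mul, one_div_mul_cancel hq0.ne', ENNReal.rpow_one]
  have e3 : ∀ a, (g a ^ (1 / p) * k a) ^ p = g a * k a ^ p := fun a => by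
    rw [ENNReal.mul_rpow_of_nonneg _ _ hp0.le, ← ENNReal.rpow_mul, one_div_mul_cancel hp0.ne',
      ENNReal.rpow_one]
  simp only [e1, e2, e3] at h
  calc _ ≤ _ := ENNReal.rpow_le_rpow h hp0.le
    _ = _ := by
      rw [ENNReal.mul_rpow_of_nonneg _ _ hp0.le, ← ENNReal.rpow_mul, ← ENNReal.rpow_mul,
        one_div_mul_cancel hp0.ne', ENNReal.rpow_one]
      congr 2
      have : 1 / q = 1 - 1 / p := by linarith
      rw [this]; field_simp

theorem lintegral_ball_enorm_rpow_lt_top {d : ℕ} (hd : d ≠ 0) {s : ℝ} (hs : -(d : ℝ) < s)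
    (R : ℝ) : ∫⁻ v in Metric.ball (0 : Fin d → ℝ) R, ‖v‖ₑ ^ s < ∞ := by
  have : Nonempty (Fin d) := ⟨⟨0, Nat.pos_of_ne_zero hd⟩⟩
  have h : IntegrableOn (fun v : Fin d → ℝ => ‖v‖ ^ s) (Metric.ball 0 R) := by
    rw [integrableOn_fun_norm_addHaar volume (f := fun y : ℝ => y ^ s)]
    have h1 : IntegrableOn (fun y : ℝ => y ^ ((d : ℝ) - 1 + s)) (Set.Ioo 0 R) := by
      rcases le_or_gt R 0 with hR | hR
      · simp [Set.Ioo_eq_empty hR.not_gt]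
      · exact (intervalIntegral.integrableOn_Ioo_rpow_iff hR).2 (by linarith)
    refine h1.congr_fun (fun y hy => ?_) measurableSet_Ioo
    have h2 : ((d - 1 : ℕ) : ℝ) = (d : ℝ) - 1 := by
      rw [Nat.cast_sub (Nat.one_le_iff_ne_zero.2 hd), Nat.cast_one]
    simp only [Module.finrank_fintype_fun_eq_card, Fintype.card_fin, smul_eq_mul]
    rw [← Real.rpow_natCast, h2, ← Real.rpow_add hy.1]
  refine lt_of_le_of_lt (le_of_eq ?_) h.lintegral_lt_top
  refine lintegral_congr_ae (ae_restrict_of_ae ?_)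
  have : ∀ᵐ v : Fin d → ℝ, v ≠ 0 := by simp [ae_iff]
  filter_upwards [this] with v hv
  rw [← ofReal_norm, ENNReal.ofReal_rpow_of_pos (norm_pos_iff.2 hv)]

theorem lintegral_comp_add_smul_sub {d : ℕ} (g : (Fin d → ℝ) → ℝ≥0∞) (x : Fin d → ℝ)
    {t : ℝ} (ht : 0 < t) :
    ∫⁻ z, g (x + t • (z - x)) = ENNReal.ofReal (t ^ (-(d : ℝ))) * ∫⁻ y, g y := by
  rw [lintegral_sub_right_eq_self (fun z => g (x + t • z)) x]
  have h := Measure.map_addHaar_smul (volume : Measure (Fin d → ℝ)) ht.ne'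
  have h2 : ∫⁻ z : Fin d → ℝ, g (x + t • z) =
      ∫⁻ z, g (x + z) ∂(Measure.map (t • ·) (volume : Measure (Fin d → ℝ))) :=
    ((Homeomorph.smulOfNeZero t ht.ne').toMeasurableEquiv.measurableEmbedding.lintegral_map
      (fun z => g (x + z))).symm
  rw [h2, h, lintegral_smul_measure, lintegral_add_left_eq_self g x]
  simp [abs_of_pos (inv_pos.2 (pow_pos ht d)), Real.rpow_neg ht.le]

theorem enorm_sub_le_lintegral_enorm_fderiv {E : Type*} [NormedAddCommGroup E] [NormedSpace ℝ E]
    {f : E → ℝ} (hf : ContDiff ℝ 1 f) (x z : E) :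
    ‖f z - f x‖ₑ ≤ ∫⁻ t in Set.Ioo (0 : ℝ) 1, ‖fderiv ℝ f (x + t • (z - x))‖ₑ * ‖z - x‖ₑ := by
  have hd : ∀ t : ℝ, HasDerivAt (fun t : ℝ => f (x + t • (z - x)))
      (fderiv ℝ f (x + t • (z - x)) (z - x)) t := fun t => by
    have h1 : HasDerivAt (fun t : ℝ => x + t • (z - x)) (z - x) t := by
      simpa using ((hasDerivAt_id t).smul_const (z - x)).const_add x
    exact ((hf.differentiable one_ne_zero) _).hasFDerivAt.comp_hasDerivAt t h1
  have hc : Continuous fun t : ℝ => fderiv ℝ f (x + t • (z - x)) (z - x) := by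
    have := hf.continuous_fderiv one_ne_zero
    fun_prop
  have h := intervalIntegral.integral_eq_sub_of_hasDerivAt (a := 0) (b := 1)
    (fun t _ => hd t) (hc.intervalIntegrable _ _)
  simp only [one_smul, zero_smul, add_zero, add_sub_cancel] at h
  rw [← h, intervalIntegral.integral_of_le zero_le_one, integral_Ioc_eq_integral_Ioo]
  refine (enorm_integral_le_lintegral_enorm _).trans (lintegral_mono fun t => ?_)
  exact ContinuousLinearMap.le_opENorm _ _

theorem lintegral_indicator_rpow_neg_le {d : ℕ} (hd : 2 ≤ d) {ρ : ℝ} (hρ : 0 ≤ ρ) :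
    ∫⁻ t in Set.Ioo (0 : ℝ) 1, (Set.Ici ρ).indicator (fun t => ENNReal.ofReal (t ^ (-(d : ℝ)))) t
      ≤ ENNReal.ofReal ρ ^ (1 - d : ℝ) := by
  have hd' : (2 : ℝ) ≤ d := by exact_mod_cast hd
  rcases hρ.eq_or_lt with rfl | hρ
  · rw [ENNReal.ofReal_zero, ENNReal.zero_rpow_of_neg (by linarith)]
    exact le_top
  calc _ ≤ ∫⁻ t in Set.Ici ρ, ENNReal.ofReal (t ^ (-(d : ℝ))) := by
        rw [← lintegral_indicator measurableSet_Ici]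
        exact lintegral_mono' Measure.restrict_le_self le_rfl
    _ = ENNReal.ofReal (∫ t in Set.Ioi ρ, t ^ (-(d : ℝ))) := by
        rw [setLIntegral_congr Ioi_ae_eq_Ici.symm, ofReal_integral_eq_lintegral_ofReal]
        · exact integrableOn_Ioi_rpow_of_lt (by linarith) hρ
        · filter_upwards [ae_restrict_mem measurableSet_Ioi] with t ht
          exact Real.rpow_nonneg (hρ.trans ht).le _
    _ ≤ _ := by
        rw [integral_Ioi_rpow_of_lt (by linarith) hρ, ENNReal.ofReal_rpow_of_pos hρ]
        apply ENNReal.ofReal_le_ofReal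
        rw [neg_div, ← div_neg, show -(d : ℝ) + 1 = 1 - d by ring]
        exact div_le_self (Real.rpow_nonneg hρ.le _) (by linarith)

theorem norm_sub_le_one_of_mem_Icc {d : ℕ} {x y : Fin d → ℝ} (hx : x ∈ Set.Icc 0 1)
    (hy : y ∈ Set.Icc 0 1) : ‖y - x‖ ≤ 1 := by
  refine (pi_norm_le_iff_of_nonneg zero_le_one).2 fun i => ?_
  have h1 := hx.1 i
  have h2 := hx.2 i
  have h3 := hy.1 i
  have h4 := hy.2 i
  simp only [Pi.zero_apply, Pi.one_apply, Pi.sub_apply] at *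
  rw [Real.norm_eq_abs, abs_le]
  constructor <;> linarith

theorem setLIntegral_Icc_comp_add_smul_sub_le {d : ℕ} (F : (Fin d → ℝ) → ℝ≥0∞)
    {x : Fin d → ℝ} (hx : x ∈ Set.Icc 0 1) {t : ℝ} (ht : t ∈ Set.Ioo (0 : ℝ) 1) :
    ∫⁻ z in Set.Icc (0 : Fin d → ℝ) 1, F (x + t • (z - x)) ≤
      ∫⁻ y in Set.Icc (0 : Fin d → ℝ) 1, F y *
        (Set.Ici ‖y - x‖).indicator (fun t => ENNReal.ofReal (t ^ (-(d : ℝ)))) t := by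
  have hm : MeasurableSet (Set.Icc (0 : Fin d → ℝ) 1) := measurableSet_Icc
  set g : (Fin d → ℝ) → ℝ≥0∞ := fun y =>
    (Set.Icc (0 : Fin d → ℝ) 1).indicator F y * (Set.Ici ‖y - x‖).indicator 1 t with hg
  calc _ ≤ ∫⁻ z, g (x + t • (z - x)) := by
        rw [← lintegral_indicator hm]
        refine lintegral_mono fun z => ?_
        by_cases hz : z ∈ Set.Icc (0 : Fin d → ℝ) 1
        · have h1 : x + t • (z - x) ∈ Set.Icc (0 : Fin d → ℝ) 1 :=
            (convex_Icc _ _).add_smul_sub_mem hx hz ⟨ht.1.le, ht.2.le⟩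
          have h2 : t ∈ Set.Ici ‖x + t • (z - x) - x‖ := by
            rw [add_sub_cancel_left, norm_smul, Real.norm_of_nonneg ht.1.le]
            exact mul_le_of_le_one_right ht.1.le (norm_sub_le_one_of_mem_Icc hx hz)
          simp only [hg, Set.indicator_of_mem hz, Set.indicator_of_mem h1, Set.indicator_of_mem h2,
            Pi.one_apply, mul_one, le_refl]
        · simp [Set.indicator_of_notMem hz]
    _ = _ := by
        rw [lintegral_comp_add_smul_sub g x ht.1, ← lintegral_const_mul' _ _ ENNReal.ofReal_ne_top,
          ← lintegral_indicator hm]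
        refine lintegral_congr fun y => ?_
        by_cases hy : y ∈ Set.Icc (0 : Fin d → ℝ) 1 <;> by_cases h : t ∈ Set.Ici ‖y - x‖ <;>
          simp [hg, hy, h, mul_comm]

theorem enorm_le_lintegral_enorm_fderiv_mul {d : ℕ} (hd : 2 ≤ d) {f : (Fin d → ℝ) → ℝ}
    (hf : ContDiff ℝ 1 f) (hf0 : ∫ x in Set.Icc (0 : Fin d → ℝ) 1, f x = 0)
    {x : Fin d → ℝ} (hx : x ∈ Set.Icc 0 1) :
    ‖f x‖ₑ ≤ ∫⁻ y in Set.Icc (0 : Fin d → ℝ) 1,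
      ‖fderiv ℝ f y‖ₑ * ‖y - x‖ₑ ^ (1 - d : ℝ) := by
  have hc := hf.continuous_fderiv one_ne_zero
  have hvol : volume (Set.Icc (0 : Fin d → ℝ) 1) = 1 := by simp [Real.volume_Icc_pi]
  have hm : MeasurableSet (Set.Icc (0 : Fin d → ℝ) 1) := measurableSet_Icc
  have hfi : IntegrableOn f (Set.Icc (0 : Fin d → ℝ) 1) :=
    hf.continuous.continuousOn.integrableOn_compact isCompact_Icc
  have h0 : ∫ z in Set.Icc (0 : Fin d → ℝ) 1, (f z - f x) = - f x := by
    rw [integral_sub hfi (integrableOn_const (by simp [hvol])), hf0]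
    simp [Measure.real, hvol]
  calc ‖f x‖ₑ = ‖∫ z in Set.Icc (0 : Fin d → ℝ) 1, (f z - f x)‖ₑ := by rw [h0, enorm_neg]
    _ ≤ ∫⁻ z in Set.Icc (0 : Fin d → ℝ) 1, ‖f z - f x‖ₑ := enorm_integral_le_lintegral_enorm _
    _ ≤ ∫⁻ z in Set.Icc (0 : Fin d → ℝ) 1, ∫⁻ t in Set.Ioo (0 : ℝ) 1,
          ‖fderiv ℝ f (x + t • (z - x))‖ₑ := by
        refine setLIntegral_mono' hm fun z hz => ?_
        refine (enorm_sub_le_lintegral_enorm_fderiv hf x z).trans (lintegral_mono fun t => ?_)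
        refine mul_le_of_le_one_right' ?_
        rw [← ofReal_norm, ENNReal.ofReal_le_one]
        exact norm_sub_le_one_of_mem_Icc hx hz
    _ = ∫⁻ t in Set.Ioo (0 : ℝ) 1, ∫⁻ z in Set.Icc (0 : Fin d → ℝ) 1,
          ‖fderiv ℝ f (x + t • (z - x))‖ₑ := by
        apply lintegral_lintegral_swap
        have : Continuous fun p : (Fin d → ℝ) × ℝ => fderiv ℝ f (x + p.2 • (p.1 - x)) := by
          fun_prop
        exact this.enorm.measurable.aemeasurable
    _ ≤ ∫⁻ t in Set.Ioo (0 : ℝ) 1, ∫⁻ y in Set.Icc (0 : Fin d → ℝ) 1, ‖fderiv ℝ f y‖ₑ *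
          (Set.Ici ‖y - x‖).indicator (fun t => ENNReal.ofReal (t ^ (-(d : ℝ)))) t :=
        setLIntegral_mono' measurableSet_Ioo fun t ht =>
          setLIntegral_Icc_comp_add_smul_sub_le (fun y => ‖fderiv ℝ f y‖ₑ) hx ht
    _ = ∫⁻ y in Set.Icc (0 : Fin d → ℝ) 1, ∫⁻ t in Set.Ioo (0 : ℝ) 1, ‖fderiv ℝ f y‖ₑ *
          (Set.Ici ‖y - x‖).indicator (fun t => ENNReal.ofReal (t ^ (-(d : ℝ)))) t := by
        apply lintegral_lintegral_swap
        refine Measurable.aemeasurable (Measurable.mul (f := fun p : ℝ × (Fin d → ℝ) =>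
          ‖fderiv ℝ f p.2‖ₑ) (hc.enorm.measurable.comp measurable_snd) ?_)
        have : (fun p : ℝ × (Fin d → ℝ) => (Set.Ici ‖p.2 - x‖).indicator
            (fun t => ENNReal.ofReal (t ^ (-(d : ℝ)))) p.1) =
            {p : ℝ × (Fin d → ℝ) | ‖p.2 - x‖ ≤ p.1}.indicator
              (fun p => ENNReal.ofReal (p.1 ^ (-(d : ℝ)))) := by
          ext p
          simp [Set.indicator_apply]
        rw [this]
        refine Measurable.indicator (by fun_prop) (measurableSet_le (by fun_prop) measurable_fst)
    _ ≤ _ := by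
        refine lintegral_mono fun y => ?_
        rw [lintegral_const_mul' _ _ (by finiteness), ← ofReal_norm (y - x)]
        gcongr
        exact lintegral_indicator_rpow_neg_le hd (norm_nonneg _)

theorem setLIntegral_Icc_enorm_sub_rpow_le {d : ℕ} (s : ℝ) {y : Fin d → ℝ}
    (hy : y ∈ Set.Icc 0 1) :
    ∫⁻ x in Set.Icc (0 : Fin d → ℝ) 1, ‖y - x‖ₑ ^ s ≤
      ∫⁻ v in Metric.ball (0 : Fin d → ℝ) 2, ‖v‖ₑ ^ s := by
  rw [← lintegral_indicator measurableSet_Icc, ← lintegral_indicator Metric.isOpen_ball.measurableSet,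
    ← lintegral_sub_left_eq_self
      ((Metric.ball (0 : Fin d → ℝ) 2).indicator fun v => ‖v‖ₑ ^ s) y]
  refine lintegral_mono fun x => ?_
  by_cases hx : x ∈ Set.Icc (0 : Fin d → ℝ) 1
  · have : y - x ∈ Metric.ball (0 : Fin d → ℝ) 2 := by
      rw [mem_ball_zero_iff]
      linarith [norm_sub_le_one_of_mem_Icc hx hy]
    rw [Set.indicator_of_mem hx, Set.indicator_of_mem this]
  · simp [Set.indicator_of_notMem hx]

/-- The potential of a density `g` on the unit cube against the kernel `‖y - x‖ ^ (1 - d)`. -/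
noncomputable def cubePotential {d : ℕ} (g : (Fin d → ℝ) → ℝ≥0∞) (x : Fin d → ℝ) : ℝ≥0∞ :=
  ∫⁻ y in Set.Icc (0 : Fin d → ℝ) 1, g y * ‖y - x‖ₑ ^ (1 - d : ℝ)

theorem measurable_enorm_sub_rpow {d : ℕ} (s : ℝ) :
    Measurable fun p : (Fin d → ℝ) × (Fin d → ℝ) => ‖p.2 - p.1‖ₑ ^ s :=
  ((measurable_snd.sub measurable_fst).enorm).pow_const s

theorem measurable_cubePotential {d : ℕ} {g : (Fin d → ℝ) → ℝ≥0∞} (hg : Measurable g) :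
    Measurable (cubePotential g) :=
  Measurable.lintegral_prod_right' (f := fun p : (Fin d → ℝ) × (Fin d → ℝ) =>
    g p.2 * ‖p.2 - p.1‖ₑ ^ (1 - d : ℝ))
    ((hg.comp measurable_snd).mul (measurable_enorm_sub_rpow _))

theorem setLIntegral_setLIntegral_mul_enorm_sub_rpow_le {d : ℕ} (s : ℝ)
    {g : (Fin d → ℝ) → ℝ≥0∞} (hg : Measurable g) :
    ∫⁻ x in Set.Icc (0 : Fin d → ℝ) 1, ∫⁻ y in Set.Icc (0 : Fin d → ℝ) 1, g y * ‖y - x‖ₑ ^ s ≤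
      (∫⁻ y in Set.Icc (0 : Fin d → ℝ) 1, g y) *
        ∫⁻ v in Metric.ball (0 : Fin d → ℝ) 2, ‖v‖ₑ ^ s := by
  rw [lintegral_lintegral_swap
    ((hg.comp measurable_snd).mul (measurable_enorm_sub_rpow s)).aemeasurable,
    ← lintegral_mul_const _ hg]
  refine setLIntegral_mono' measurableSet_Icc fun y hy => ?_
  rw [lintegral_const_mul _ (by fun_prop)]
  exact mul_le_mul' le_rfl (setLIntegral_Icc_enorm_sub_rpow_le s hy)

theorem lintegral_cubePotential_rpow_le {d : ℕ} {p : ℝ} (hp : 1 < p)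
    {g : (Fin d → ℝ) → ℝ≥0∞} (hg : Measurable g) :
    ∫⁻ x in Set.Icc (0 : Fin d → ℝ) 1, cubePotential g x ^ p ≤
      (∫⁻ y in Set.Icc (0 : Fin d → ℝ) 1, g y) ^ p *
        ∫⁻ v in Metric.ball (0 : Fin d → ℝ) 2, ‖v‖ₑ ^ ((1 - d : ℝ) * p) := by
  set A := ∫⁻ y in Set.Icc (0 : Fin d → ℝ) 1, g y with hA
  calc _ ≤ ∫⁻ x in Set.Icc (0 : Fin d → ℝ) 1, A ^ (p - 1) *
        ∫⁻ y in Set.Icc (0 : Fin d → ℝ) 1, g y * ‖y - x‖ₑ ^ ((1 - d : ℝ) * p) := by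
        refine lintegral_mono fun x => ?_
        simp only [ENNReal.rpow_mul]
        exact rpow_lintegral_mul_le _ hp hg.aemeasurable (by fun_prop)
    _ = A ^ (p - 1) * ∫⁻ x in Set.Icc (0 : Fin d → ℝ) 1,
        ∫⁻ y in Set.Icc (0 : Fin d → ℝ) 1, g y * ‖y - x‖ₑ ^ ((1 - d : ℝ) * p) :=
        lintegral_const_mul _ (Measurable.lintegral_prod_right'
          (f := fun q : (Fin d → ℝ) × (Fin d → ℝ) => g q.2 * ‖q.2 - q.1‖ₑ ^ ((1 - d : ℝ) * p))
          ((hg.comp measurable_snd).mul (measurable_enorm_sub_rpow _)))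
    _ ≤ A ^ (p - 1) * (A * ∫⁻ v in Metric.ball (0 : Fin d → ℝ) 2, ‖v‖ₑ ^ ((1 - d : ℝ) * p)) := by
        gcongr
        exact setLIntegral_setLIntegral_mul_enorm_sub_rpow_le _ hg
    _ = _ := by
        rw [← mul_assoc]
        congr 1
        nth_rewrite 2 [← ENNReal.rpow_one A]
        rw [← ENNReal.rpow_add_of_nonneg _ _ (by linarith) zero_le_one, sub_add_cancel]

theorem enorm_sq_le_cubePotential_mul {d : ℕ} (hd : 2 ≤ d) {V : (Fin d → ℝ) → ℝ}
    (hV : Measurable V) {f : (Fin d → ℝ) → ℝ} (hf : ContDiff ℝ 1 f)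
    (hf0 : ∫ x in Set.Icc (0 : Fin d → ℝ) 1, f x = 0) {x : Fin d → ℝ} (hx : x ∈ Set.Icc 0 1) :
    ‖f x‖ₑ ^ (2 : ℝ) ≤ cubePotential (fun y => ENNReal.ofReal (Real.exp (V y))) x *
      cubePotential (fun y => ENNReal.ofReal (‖fderiv ℝ f y‖ ^ 2 * Real.exp (-V y))) x := by
  have hc := hf.continuous_fderiv one_ne_zero
  have hinv : ∀ y, ENNReal.ofReal (Real.exp (V y)) * ENNReal.ofReal (Real.exp (-V y)) = 1 :=
    fun y => by rw [← ENNReal.ofReal_mul (Real.exp_pos _).le, ← Real.exp_add]; simp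
  have h := rpow_lintegral_mul_le (volume.restrict (Set.Icc (0 : Fin d → ℝ) 1)) one_lt_two
    (g := fun y => ENNReal.ofReal (Real.exp (V y)) * ‖y - x‖ₑ ^ (1 - d : ℝ))
    (k := fun y => ‖fderiv ℝ f y‖ₑ * ENNReal.ofReal (Real.exp (-V y)))
    (by fun_prop) (by fun_prop)
  rw [show (2 : ℝ) - 1 = 1 by norm_num, ENNReal.rpow_one] at h
  refine (ENNReal.rpow_le_rpow (enorm_le_lintegral_enorm_fderiv_mul hd hf hf0 hx)
    zero_le_two).trans (le_trans (le_of_eq ?_) (h.trans (le_of_eq ?_)))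
  · congr 1
    refine lintegral_congr fun y => ?_
    calc _ = (ENNReal.ofReal (Real.exp (V y)) * ENNReal.ofReal (Real.exp (-V y))) *
          (‖fderiv ℝ f y‖ₑ * ‖y - x‖ₑ ^ (1 - d : ℝ)) := by rw [hinv, one_mul]
      _ = _ := by ring
  · rw [cubePotential, cubePotential]
    congr 1
    refine lintegral_congr fun y => ?_
    rw [ENNReal.rpow_two, ENNReal.ofReal_mul (by positivity), ENNReal.ofReal_pow (norm_nonneg _),
      ofReal_norm]
    calc _ = (ENNReal.ofReal (Real.exp (V y)) * ENNReal.ofReal (Real.exp (-V y))) *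
          (‖fderiv ℝ f y‖ₑ ^ 2 * ENNReal.ofReal (Real.exp (-V y)) * ‖y - x‖ₑ ^ (1 - d : ℝ)) := by
            ring
      _ = _ := by rw [hinv, one_mul]

theorem ofReal_abs_rpow_mul_weight_le {a p : ℝ} (hp : 0 < p) {G H : ℝ≥0∞} (hG : G ≠ ∞)
    (h : ‖a‖ₑ ^ (2 : ℝ) ≤ G * H) :
    ENNReal.ofReal (|a| ^ (2 * p) * (1 + G.toReal) ^ (-p)) ≤ H ^ p := by
  have hG0 : 0 ≤ G.toReal := ENNReal.toReal_nonneg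
  rw [ENNReal.ofReal_mul (by positivity), ← ENNReal.ofReal_rpow_of_nonneg (abs_nonneg a)
    (by positivity), ← Real.norm_eq_abs, ofReal_norm, ENNReal.rpow_mul]
  have hw : G ^ p * ENNReal.ofReal ((1 + G.toReal) ^ (-p)) ≤ 1 := by
    rw [← ENNReal.ofReal_toReal hG, ENNReal.ofReal_rpow_of_nonneg hG0 hp.le,
      ENNReal.toReal_ofReal hG0, ← ENNReal.ofReal_mul (by positivity), ENNReal.ofReal_le_one,
      Real.rpow_neg (by positivity), ← div_eq_mul_inv, div_le_one (by positivity)]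
    exact Real.rpow_le_rpow hG0 (by linarith) hp.le
  calc _ ≤ (G * H) ^ p * ENNReal.ofReal ((1 + G.toReal) ^ (-p)) := by gcongr
    _ = (G ^ p * ENNReal.ofReal ((1 + G.toReal) ^ (-p))) * H ^ p := by
        rw [ENNReal.mul_rpow_of_nonneg _ _ hp.le]; ring
    _ ≤ H ^ p := mul_le_of_le_one_left' hw

/-- main weighted Sobolev theorem: if `d ≥ 2` and `V` is measurable and
periodic with `e^V + e^{-V} ∈ L¹(I₀)`, then there exist a positive bounded measurable
weight `w`, an exponent `r* > 2` and `c > 0` such that every centered `C¹` periodic `f`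
satisfies `(∫_{I₀} |f|^{r*} w)^{2/r*} ≤ c ∫_{I₀} |∇f|² e^{-V}`. Functions on the torus
are represented as `ℤ^d`-periodic functions on `ℝ^d`, with `I₀ = [0,1]^d`. -/
theorem stmt_16 {d : ℕ} (hd : 2 ≤ d) (V : (Fin d → ℝ) → ℝ) (hV : Measurable V)
    (hVper : ∀ (x : Fin d → ℝ) (z : Fin d → ℤ), V (x + fun i => (z i : ℝ)) = V x)
    (hint : IntegrableOn (fun x => Real.exp (V x) + Real.exp (-V x))
      (Set.Icc (0 : Fin d → ℝ) 1)) :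
    ∃ w : (Fin d → ℝ) → ℝ, Measurable w ∧ (∀ x, 0 < w x) ∧ (∃ Cw : ℝ, ∀ x, w x ≤ Cw) ∧
      ∃ r : ℝ, 2 < r ∧ ∃ c : ℝ, 0 < c ∧
        ∀ f : (Fin d → ℝ) → ℝ, ContDiff ℝ 1 f →
          (∀ (x : Fin d → ℝ) (z : Fin d → ℤ), f (x + fun i => (z i : ℝ)) = f x) →
          (∫ x in Set.Icc (0 : Fin d → ℝ) 1, f x) = 0 →
          (∫ x in Set.Icc (0 : Fin d → ℝ) 1, |f x| ^ r * w x) ^ (2 / r) ≤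
            c * ∫ x in Set.Icc (0 : Fin d → ℝ) 1,
              ‖fderiv ℝ f x‖ ^ 2 * Real.exp (-V x) := by
  have hd' : (2 : ℝ) ≤ d := by exact_mod_cast hd
  have hm : MeasurableSet (Set.Icc (0 : Fin d → ℝ) 1) := measurableSet_Icc
  set G := cubePotential (fun y => ENNReal.ofReal (Real.exp (V y))) with hGdef
  have hGm : Measurable G := measurable_cubePotential (by fun_prop)
  have hintV : IntegrableOn (fun x => Real.exp (V x)) (Set.Icc (0 : Fin d → ℝ) 1) := by
    refine Integrable.mono' hint (by fun_prop) (ae_of_all _ fun x => ?_)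
    rw [Real.norm_of_nonneg (Real.exp_pos _).le]
    exact le_add_of_nonneg_right (Real.exp_pos _).le
  have hintV' : IntegrableOn (fun x => Real.exp (-V x)) (Set.Icc (0 : Fin d → ℝ) 1) := by
    refine Integrable.mono' hint (by fun_prop) (ae_of_all _ fun x => ?_)
    rw [Real.norm_of_nonneg (Real.exp_pos _).le]
    exact le_add_of_nonneg_left (Real.exp_pos _).le
  have hGfin : ∀ᵐ x ∂volume.restrict (Set.Icc (0 : Fin d → ℝ) 1), G x < ∞ := by
    refine ae_lt_top hGm (ne_top_of_le_ne_top ?_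
      (setLIntegral_setLIntegral_mul_enorm_sub_rpow_le (1 - d : ℝ) (by fun_prop)))
    exact ENNReal.mul_ne_top hintV.lintegral_lt_top.ne
      (lintegral_ball_enorm_rpow_lt_top (by omega) (by linarith) 2).ne
  obtain ⟨p, hp, hpd⟩ : ∃ p : ℝ, 1 < p ∧ -(d : ℝ) < (1 - d : ℝ) * p := by
    refine ⟨1 + 1 / (2 * (d - 1 : ℝ)), ?_, ?_⟩
    · have : 0 < 1 / (2 * (d - 1 : ℝ)) := by
        apply one_div_pos.2; linarith
      linarith
    · have : (d - 1 : ℝ) ≠ 0 := by linarith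
      have h : (1 - d : ℝ) * (1 + 1 / (2 * (d - 1 : ℝ))) = 1 / 2 - d := by
        field_simp; ring
      rw [h]; linarith
  have hp0 : 0 < p := by linarith
  set C := ∫⁻ v in Metric.ball (0 : Fin d → ℝ) 2, ‖v‖ₑ ^ ((1 - d : ℝ) * p) with hC
  have hCfin : C ≠ ∞ := (lintegral_ball_enorm_rpow_lt_top (by omega) hpd 2).ne
  have hbase : ∀ x, 1 ≤ 1 + (G x).toReal := fun x =>
    le_add_of_nonneg_right ENNReal.toReal_nonneg
  refine ⟨fun x => (1 + (G x).toReal) ^ (-p), by fun_prop,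
    fun x => Real.rpow_pos_of_pos (by linarith [hbase x]) _,
    ⟨1, fun x => Real.rpow_le_one_of_one_le_of_nonpos (hbase x) (by linarith)⟩,
    2 * p, by linarith, C.toReal ^ (1 / p) + 1, by positivity, fun f hf _ hf0 => ?_⟩
  have hc := hf.continuous_fderiv one_ne_zero
  have hcf := hf.continuous
  have hgi : IntegrableOn (fun x => ‖fderiv ℝ f x‖ ^ 2 * Real.exp (-V x))
      (Set.Icc (0 : Fin d → ℝ) 1) :=
    hintV'.continuousOn_mul (hc.norm.pow 2).continuousOn isCompact_Icc
  set D := ∫ x in Set.Icc (0 : Fin d → ℝ) 1, ‖fderiv ℝ f x‖ ^ 2 * Real.exp (-V x) with hD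
  have hD0 : 0 ≤ D := integral_nonneg fun x => by positivity
  have hDl : ∫⁻ x in Set.Icc (0 : Fin d → ℝ) 1,
      ENNReal.ofReal (‖fderiv ℝ f x‖ ^ 2 * Real.exp (-V x)) = ENNReal.ofReal D :=
    (ofReal_integral_eq_lintegral_ofReal hgi (ae_of_all _ fun x => by positivity)).symm
  have hI0 : ∀ x, 0 ≤ |f x| ^ (2 * p) * (1 + (G x).toReal) ^ (-p) := fun x => by positivity
  have hle : ∫⁻ x in Set.Icc (0 : Fin d → ℝ) 1,
      ENNReal.ofReal (|f x| ^ (2 * p) * (1 + (G x).toReal) ^ (-p)) ≤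
        ENNReal.ofReal D ^ p * C := by
    rw [← hDl]
    refine le_trans (lintegral_mono_ae ?_) (lintegral_cubePotential_rpow_le hp (by fun_prop))
    filter_upwards [hGfin, ae_restrict_mem hm] with x hx hxQ
    exact ofReal_abs_rpow_mul_weight_le hp0 hx.ne
      (enorm_sq_le_cubePotential_mul hd hV hf hf0 hxQ)
  have hI : ∫ x in Set.Icc (0 : Fin d → ℝ) 1, |f x| ^ (2 * p) * (1 + (G x).toReal) ^ (-p) ≤
      D ^ p * C.toReal := by
    rw [integral_eq_lintegral_of_nonneg_ae (ae_of_all _ hI0)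
      (Measurable.aestronglyMeasurable (by fun_prop))]
    refine (ENNReal.toReal_mono (by finiteness) hle).trans (le_of_eq ?_)
    rw [ENNReal.toReal_mul, ← ENNReal.toReal_rpow, ENNReal.toReal_ofReal hD0]
  rw [show 2 / (2 * p) = 1 / p by field_simp]
  calc _ ≤ (D ^ p * C.toReal) ^ (1 / p) :=
        Real.rpow_le_rpow (integral_nonneg hI0) hI (by positivity)
    _ = C.toReal ^ (1 / p) * D := by
        rw [Real.mul_rpow (by positivity) ENNReal.toReal_nonneg, ← Real.rpow_mul hD0,
          mul_one_div_cancel hp0.ne', Real.rpow_one, mul_comm]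
    _ ≤ _ := by gcongr; linarith
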